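/- There exist universal constants κ > 0 and m₀ such that the following holds for all integers m ≥ m₀ and n with 2 ≤ n ≤ m^{1/3} and n | m, where k = m/n. For every positive integer λ with λ ≤ log₂(m^{1/3})/log₂(2n) and every integer z with 1 ≤ z ≤ 2^{2√m}: if X_1, …, X_z are independent random subsets of [m], each uniformly distributed among the subsets of [m] of size k, then the probability that there exist indices ℓ_1, …, ℓ_λ ∈ [z] with ([m]∖X_{ℓ_1}) ∪ ⋯ ∪ ([m]∖X_{ℓ_λ}) = [m] is at most 2^{−κ√m}. -/

import Mathlib

/-- The term of index `k` is the largest in the binomial expansion of `(1 + q) ^ m` when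
`m = (q + 1) * k`. -/
theorem choose_mul_pow_le_choose_mul_pow {q k : ℕ} (hq : 0 < q) (j : ℕ) :
    ((q + 1) * k).choose j * q ^ ((q + 1) * k - j) ≤
      ((q + 1) * k).choose k * q ^ ((q + 1) * k - k) := by
  obtain ⟨m, hm⟩ : ∃ m, m = (q + 1) * k := ⟨_, rfl⟩
  rw [← hm]
  have hkm : k ≤ m := by rw [hm]; nlinarith
  have hstep : ∀ i, i < m → m.choose (i + 1) * q ^ (m - (i + 1)) * (q * (i + 1)) =
      m.choose i * q ^ (m - i) * (m - i) := by
    intro i hi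
    have h1 := Nat.choose_succ_right_eq m i
    have h2 : m - i = m - (i + 1) + 1 := by omega
    have h3 : q ^ (m - i) = q ^ (m - (i + 1)) * q := by rw [h2, pow_succ]
    rw [h3]
    linear_combination q ^ (m - (i + 1)) * q * h1
  rcases le_total j k with hjk | hkj
  · induction hjk using Nat.decreasingInduction with
    | self => exact le_rfl
    | of_succ i hi ih =>
      refine le_trans ?_ ih
      have him : i < m := by omega
      have hs := hstep i him
      have hle : q * (i + 1) ≤ m - i := by
        have : (q + 1) * (i + 1) ≤ m := by rw [hm]; gcongr; omega
        have : (q + 1) * (i + 1) = q * (i + 1) + i + 1 := by ring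
        omega
      have hpos : 0 < m - i := by omega
      refine Nat.le_of_mul_le_mul_right ?_ hpos
      rw [← hs]
      gcongr
  · induction j, hkj using Nat.le_induction with
    | base => exact le_rfl
    | succ i hi ih =>
      refine le_trans ?_ ih
      rcases lt_or_ge i m with him | him
      · have hs := hstep i him
        have hle : m - i ≤ q * (i + 1) := by
          have : m ≤ (q + 1) * i := by rw [hm]; gcongr
          have : (q + 1) * i = q * i + i := by ring
          have : q * (i + 1) = q * i + q := by ring
          omega
        have hpos : 0 < q * (i + 1) := by positivity
        refine Nat.le_of_mul_le_mul_right ?_ hpos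
        rw [hs]
        gcongr
      · simp [Nat.choose_eq_zero_of_lt (show m < i + 1 by omega)]

theorem pow_le_succ_mul_choose_mul_pow {q k : ℕ} (hq : 0 < q) :
    (q + 1) ^ ((q + 1) * k) ≤
      ((q + 1) * k + 1) * (((q + 1) * k).choose k * q ^ ((q + 1) * k - k)) := by
  rw [add_comm q 1, add_pow, add_comm 1 q]
  calc _ ≤ ∑ _j ∈ Finset.range ((q + 1) * k + 1),
        ((q + 1) * k).choose k * q ^ ((q + 1) * k - k) := by
        refine Finset.sum_le_sum fun j _ => ?_
        rw [one_pow, one_mul, mul_comm]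
        exact choose_mul_pow_le_choose_mul_pow hq j
    _ = _ := by simp

/-- Families of `k`-sets with empty intersection, counted through the functions
`α → ι → Fin (q + 1)` avoiding the value `0`. -/
theorem card_empty_inter_mul_le {α ι : Type*} [Fintype α] [DecidableEq α] [Fintype ι]
    [DecidableEq ι] (q k : ℕ) :
    (Finset.univ.filter (fun X : ι → {s : Finset α // s.card = k} =>
        ∀ a, ∃ i, a ∉ (X i).1)).card *
      (q ^ (Fintype.card α - k)) ^ Fintype.card ι ≤
      ((q + 1) ^ Fintype.card ι - 1) ^ Fintype.card α := by
  classical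
  let T : Finset (α → ι → Fin (q + 1)) := Fintype.piFinset fun _ => Finset.univ.erase 0
  have hT : T.card = ((q + 1) ^ Fintype.card ι - 1) ^ Fintype.card α := by
    simp [T, Fintype.card_piFinset, Finset.card_erase_of_mem]
  let B := Finset.univ.filter (fun X : ι → {s : Finset α // s.card = k} =>
        ∀ a, ∃ i, a ∉ (X i).1)
  let F : (ι → {s : Finset α // s.card = k}) → Finset (α → ι → Fin (q + 1)) := fun X =>
    Fintype.piFinset fun a => Fintype.piFinset fun i =>
      if a ∈ (X i).1 then {0} else Finset.univ.erase 0
  have hmem : ∀ X g, g ∈ F X ↔ ∀ a i, (g a i = 0 ↔ a ∈ (X i).1) := by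
    intro X g
    simp only [F, Fintype.mem_piFinset]
    refine forall_congr' fun a => forall_congr' fun i => ?_
    split_ifs with h <;> simp [h]
  have hF : ∀ X, (F X).card = (q ^ (Fintype.card α - k)) ^ Fintype.card ι := by
    intro X
    simp only [F, Fintype.card_piFinset]
    rw [Finset.prod_comm]
    rw [Finset.prod_congr rfl (g := fun _ => q ^ (Fintype.card α - k)), Finset.prod_const,
      Finset.card_univ]
    intro i _
    have hcompl : Fintype.card α - k = (X i).1ᶜ.card := by rw [Finset.card_compl, (X i).2]
    rw [hcompl, ← Finset.prod_const, ← Finset.prod_mul_prod_compl (X i).1]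
    rw [Finset.prod_eq_one, one_mul]
    · refine Finset.prod_congr rfl fun a ha => ?_
      rw [if_neg (by simpa using ha)]
      simp
    · intro a ha
      simp [ha]
  have hdisj : (B : Set (ι → {s : Finset α // s.card = k})).PairwiseDisjoint F := by
    intro X _ Y _ hXY
    refine Finset.disjoint_left.2 fun g hX hY => hXY ?_
    rw [hmem] at hX hY
    ext i a
    rw [← hX, ← hY]
  have hsub : B.biUnion F ⊆ T := by
    intro g hg
    obtain ⟨X, hX, hgX⟩ := Finset.mem_biUnion.1 hg
    rw [hmem] at hgX
    refine Fintype.mem_piFinset.2 fun a => Finset.mem_erase.2 ⟨fun h0 => ?_, Finset.mem_univ _⟩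
    obtain ⟨i, hi⟩ := (Finset.mem_filter.1 hX).2 a
    exact hi ((hgX a i).1 (by simp [h0]))
  rw [← hT]
  refine le_trans (le_of_eq ?_) (Finset.card_le_card hsub)
  rw [Finset.card_biUnion hdisj, Finset.sum_congr rfl fun X _ => hF X, Finset.sum_const, smul_eq_mul]

theorem card_filter_restrict {ι A : Type*} [Fintype ι] [DecidableEq ι] [Fintype A]
    (L : Finset ι) (P : ({i // i ∈ L} → A) → Prop) [DecidablePred P] :
    (Finset.univ.filter (fun X : ι → A => P fun i => X i)).card =
      (Finset.univ.filter P).card * Fintype.card A ^ (Fintype.card ι - L.card) := by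
  classical
  have h := Fintype.card_congr
    ((Equiv.piEquivPiSubtypeProd (fun i => i ∈ L) (fun _ : ι => A)).subtypeEquiv
      (p := fun X : ι → A => P fun i => X i) (q := fun Y => P Y.1) fun X => Iff.rfl)
  rw [Fintype.card_subtype] at h
  rw [h, Fintype.card_congr (Equiv.prodSubtypeFstEquivSubtypeProd (p := P)),
    Fintype.card_prod, Fintype.card_subtype]
  congr 1
  simp [Fintype.card_subtype_compl]

/-- The probability that a fixed subfamily of independent uniform `k`-sets has empty
intersection. -/
theorem prob_empty_inter_le {ι : Type*} [Fintype ι] [DecidableEq ι] {m n : ℕ} (hn : 2 ≤ n)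
    (hnm : n ∣ m) (L : Finset ι) :
    ((Finset.univ.filter (fun X : ι → {s : Finset (Fin m) // s.card = m / n} =>
        ∀ a, ∃ i ∈ L, a ∉ (X i).1)).card : ℝ) ≤
      (m + 1) ^ L.card * Real.exp (-(m / n ^ L.card)) *
        Fintype.card (ι → {s : Finset (Fin m) // s.card = m / n}) := by
  classical
  obtain ⟨k, rfl⟩ := hnm
  obtain ⟨q, rfl⟩ : ∃ q, n = q + 1 := ⟨n - 1, by omega⟩
  have hq : 0 < q := by omega
  rw [Nat.mul_div_cancel_left _ (Nat.succ_pos q)]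
  set r := L.card with hr
  set m := (q + 1) * k with hm
  set A := {s : Finset (Fin m) // s.card = k}
  have hA : Fintype.card A = m.choose k := by simp [A]
  have hkm : k ≤ m := by rw [hm]; nlinarith
  have hmode := pow_le_succ_mul_choose_mul_pow (k := k) hq
  rw [← hm] at hmode
  have hsplit := card_filter_restrict (A := A) L
    (fun Y => ∀ a, ∃ i, a ∉ (Y i).1)
  have hbad := card_empty_inter_mul_le (α := Fin m) (ι := {i // i ∈ L}) q k
  simp only [Fintype.card_fin, Fintype.card_coe] at hbad
  rw [← hr] at hsplit hbad
  set b := (Finset.univ.filter (fun Y : {i // i ∈ L} → A => ∀ a, ∃ i, a ∉ (Y i).1)).card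
  have hcount : (Finset.univ.filter (fun X : ι → A => ∀ a, ∃ i ∈ L, a ∉ (X i).1)).card =
      b * Fintype.card A ^ (Fintype.card ι - r) := by
    rw [← hsplit]
    congr 1
    ext X
    simp
  rw [hcount, Fintype.card_fun, hA]
  have hrι : r ≤ Fintype.card ι := Finset.card_le_univ L
  have hpow : m.choose k ^ Fintype.card ι =
      m.choose k ^ r * m.choose k ^ (Fintype.card ι - r) := by
    rw [← pow_add]; congr 1; omega
  rw [hpow]
  push_cast
  rw [← mul_assoc]
  gcongr
  have hbad' : (b : ℝ) * ((q : ℝ) ^ (m - k)) ^ r ≤ (((q : ℝ) + 1) ^ r - 1) ^ m := by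
    have h : ((b * (q ^ (m - k)) ^ r : ℕ) : ℝ) ≤ (((q + 1) ^ r - 1) ^ m : ℕ) := by
      refine Nat.cast_le.2 ?_
      convert hbad
    rw [Nat.cast_pow, Nat.cast_sub (Nat.one_le_pow _ _ (Nat.succ_pos q))] at h
    push_cast at h
    exact h
  have hmode' : ((q : ℝ) + 1) ^ m ≤ (m + 1) * (m.choose k * (q : ℝ) ^ (m - k)) := by
    exact_mod_cast hmode
  have hN : (1 : ℝ) ≤ ((q : ℝ) + 1) ^ r := one_le_pow₀ (by linarith [Nat.cast_nonneg (α := ℝ) q])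
  have hexp : (((q : ℝ) + 1) ^ r - 1) ^ m ≤
      (((q : ℝ) + 1) ^ r) ^ m * Real.exp (-(m / ((q : ℝ) + 1) ^ r)) := by
    have h1 : ((q : ℝ) + 1) ^ r - 1 ≤
        ((q : ℝ) + 1) ^ r * Real.exp (-(1 / ((q : ℝ) + 1) ^ r)) := by
      have h2 := Real.add_one_le_exp (-(1 / ((q : ℝ) + 1) ^ r))
      calc ((q : ℝ) + 1) ^ r - 1 = ((q : ℝ) + 1) ^ r * (-(1 / ((q : ℝ) + 1) ^ r) + 1) := by
            field_simp; ring
        _ ≤ _ := by gcongr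
    calc _ ≤ (((q : ℝ) + 1) ^ r * Real.exp (-(1 / ((q : ℝ) + 1) ^ r))) ^ m :=
          pow_le_pow_left₀ (by linarith) h1 m
      _ = _ := by
          rw [mul_pow, ← Real.exp_nat_mul]
          congr 2
          ring
  have hQ : (0 : ℝ) < ((q : ℝ) ^ (m - k)) ^ r := by positivity
  refine le_of_mul_le_mul_right ?_ hQ
  calc (b : ℝ) * ((q : ℝ) ^ (m - k)) ^ r
      ≤ (((q : ℝ) + 1) ^ m) ^ r * Real.exp (-(m / ((q : ℝ) + 1) ^ r)) := by
        rw [pow_right_comm ((q : ℝ) + 1)]; exact hbad'.trans hexp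
    _ ≤ ((m + 1) * (m.choose k * (q : ℝ) ^ (m - k))) ^ r *
        Real.exp (-(m / ((q : ℝ) + 1) ^ r)) := by gcongr
    _ = _ := by rw [mul_pow, mul_pow]; ring

/-- Union bound over the tuples of indices whose complements may cover everything. -/
theorem card_exists_cover_le_of_forall {m k lam z : ℕ} {c : ℝ}
    (h : ∀ L : Finset (Fin z), L.card ≤ lam →
      ((Finset.univ.filter (fun X : Fin z → {s : Finset (Fin m) // s.card = k} =>
        ∀ a, ∃ i ∈ L, a ∉ (X i).1)).card : ℝ) ≤ c) :
    ((Finset.univ.filter (fun X : Fin z → {s : Finset (Fin m) // s.card = k} =>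
      ∃ ℓs : Fin lam → Fin z, Finset.univ.biUnion (fun t => ((X (ℓs t)).1)ᶜ) =
        (Finset.univ : Finset (Fin m)))).card : ℝ) ≤ z ^ lam * c := by
  let E : (Fin lam → Fin z) → Finset (Fin z → {s : Finset (Fin m) // s.card = k}) := fun ℓs =>
    Finset.univ.filter fun X => ∀ a, ∃ i ∈ Finset.univ.image ℓs, a ∉ (X i).1
  have hsub : (Finset.univ.filter (fun X : Fin z → {s : Finset (Fin m) // s.card = k} =>
      ∃ ℓs : Fin lam → Fin z, Finset.univ.biUnion (fun t => ((X (ℓs t)).1)ᶜ) =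
        (Finset.univ : Finset (Fin m)))) ⊆ Finset.univ.biUnion E := by
    intro X hX
    obtain ⟨ℓs, h⟩ := (Finset.mem_filter.1 hX).2
    refine Finset.mem_biUnion.2 ⟨ℓs, Finset.mem_univ _, Finset.mem_filter.2
      ⟨Finset.mem_univ _, fun a => ?_⟩⟩
    obtain ⟨t, -, ht⟩ := Finset.mem_biUnion.1 (h ▸ Finset.mem_univ a)
    exact ⟨ℓs t, Finset.mem_image_of_mem _ (Finset.mem_univ t), Finset.mem_compl.1 ht⟩
  have hE : ∀ ℓs, ((E ℓs).card : ℝ) ≤ c := fun ℓs =>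
    h _ (by simpa using Finset.card_image_le (s := Finset.univ) (f := ℓs))
  calc _ ≤ ((Finset.univ.biUnion E).card : ℝ) := Nat.cast_le.2 (Finset.card_le_card hsub)
    _ ≤ ((∑ ℓs, (E ℓs).card : ℕ) : ℝ) := Nat.cast_le.2 Finset.card_biUnion_le
    _ = ∑ ℓs, ((E ℓs).card : ℝ) := Nat.cast_sum _ _
    _ ≤ ∑ _ℓs : Fin lam → Fin z, c := Finset.sum_le_sum fun ℓs _ => hE ℓs
    _ = _ := by simp

open Filter in
theorem eventually_log_le_rpow :
    ∀ᶠ m : ℕ in atTop, 1 ≤ Real.log m ∧ 6 * Real.log m ≤ (m : ℝ) ^ ((1 : ℝ) / 6) := by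
  have h1 := (Real.tendsto_log_atTop.comp tendsto_natCast_atTop_atTop).eventually_ge_atTop 1
  have h2 := tendsto_natCast_atTop_atTop.eventually
    ((isLittleO_log_rpow_atTop (r := 1 / 6) (by norm_num)).bound
      (show (0 : ℝ) < 1 / 6 by norm_num))
  filter_upwards [h1, h2] with m h1 h2
  have h1' : 1 ≤ Real.log m := h1
  refine ⟨h1', ?_⟩
  rw [Real.norm_of_nonneg (by linarith), Real.norm_of_nonneg (by positivity)] at h2
  linarith

/-- Sparsity of random complements: there are universal constants `κ > 0` and `m₀` such
that for all `m ≥ m₀`, `2 ≤ n ≤ m^{1/3}` with `n ∣ m`, `k = m/n`, every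
`1 ≤ λ ≤ log₂(m^{1/3})/log₂(2n)`, and every `1 ≤ z ≤ 2^{2√m}`: if `X_1, …, X_z` are
i.i.d. uniformly random `k`-subsets of `[m]`, the probability that some `λ` of the
complements `[m]∖X_ℓ` cover all of `[m]` is at most `2^{−κ√m}`.  (The probability of an
event under the i.i.d. uniform distribution on a finite set is the number of favorable
outcomes divided by the total number of outcomes.) -/
theorem sparsity_whp :
    ∃ κ : ℝ, 0 < κ ∧ ∃ m₀ : ℕ, ∀ m : ℕ, m₀ ≤ m → ∀ n : ℕ, 2 ≤ n →
      (n : ℝ) ≤ (m : ℝ) ^ ((1 : ℝ) / 3) → n ∣ m →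
      ∀ lam : ℕ, 1 ≤ lam →
        (lam : ℝ) ≤ Real.logb 2 ((m : ℝ) ^ ((1 : ℝ) / 3)) / Real.logb 2 (2 * n) →
      ∀ z : ℕ, 1 ≤ z → (z : ℝ) ≤ 2 ^ (2 * Real.sqrt m) →
      ((Finset.univ.filter
          (fun Xf : Fin z → {s : Finset (Fin m) // s.card = m / n} =>
            ∃ ℓs : Fin lam → Fin z,
              Finset.univ.biUnion (fun t => ((Xf (ℓs t)).1)ᶜ) =
                (Finset.univ : Finset (Fin m)))).card : ℝ) /
        (Fintype.card (Fin z → {s : Finset (Fin m) // s.card = m / n}) : ℝ) ≤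
      2 ^ (-(κ * Real.sqrt m)) := by
  obtain ⟨m₀, hm₀⟩ := Filter.eventually_atTop.1 eventually_log_le_rpow
  refine ⟨1, one_pos, m₀, ?_⟩
  intro m hm n hn _ hnm lam _ hlam z _ hz
  obtain ⟨hlog1, hlog⟩ := hm₀ m hm
  have hm0 : (0 : ℝ) < m := by
    rcases Nat.eq_zero_or_pos m with rfl | h
    · simp at hlog1; linarith
    · exact_mod_cast h
  have hn2 : (2 : ℝ) ≤ n := by exact_mod_cast hn
  have hlog2 : 0 < Real.log 2 := Real.log_pos one_lt_two
  have hlog2n : 2 * Real.log 2 ≤ Real.log (2 * n) := by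
    rw [← Real.log_rpow two_pos]
    apply Real.log_le_log <;> norm_num
    linarith
  have hlam' : lam * Real.log (2 * n) ≤ 1 / 3 * Real.log m := by
    rw [← Real.log_rpow hm0]
    rw [Real.logb, Real.logb, div_div_div_cancel_right₀ hlog2.ne', le_div_iff₀ (by linarith)] at hlam
    exact hlam
  have hlam_log : (lam : ℝ) ≤ Real.log m := by
    have := Real.log_two_gt_d9
    have : (lam : ℝ) * 1 ≤ lam * Real.log (2 * n) := by gcongr; linarith
    linarith
  have hnlam : (n : ℝ) ^ lam ≤ (m : ℝ) ^ ((1 : ℝ) / 3) := by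
    rw [← Real.log_le_log_iff (by positivity) (by positivity), Real.log_pow, Real.log_rpow hm0]
    refine le_trans ?_ hlam'
    gcongr
    linarith
  have hm1 : (1 : ℝ) ≤ m := by exact_mod_cast (by exact_mod_cast hm0 : 0 < m)
  have hquot : (m : ℝ) ^ ((2 : ℝ) / 3) ≤ m / n ^ lam := by
    rw [le_div_iff₀ (by positivity)]
    calc _ ≤ (m : ℝ) ^ ((2 : ℝ) / 3) * (m : ℝ) ^ ((1 : ℝ) / 3) := by gcongr
      _ = m := by rw [← Real.rpow_add hm0]; norm_num
  have hsqrt : Real.log m ≤ √m := by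
    rw [Real.sqrt_eq_rpow]
    calc _ ≤ (m : ℝ) ^ ((1 : ℝ) / 6) := by linarith
      _ ≤ _ := Real.rpow_le_rpow_of_exponent_le hm1 (by norm_num)
  have hlog_succ : Real.log (m + 1) ≤ 2 * √m := by
    have h2m : (2 : ℝ) ≤ m := by
      have := Real.log_le_sub_one_of_pos hm0
      linarith
    calc Real.log (m + 1) ≤ Real.log (m ^ 2) := by
          apply Real.log_le_log <;> nlinarith
      _ = 2 * Real.log m := by rw [Real.log_pow]; norm_num
      _ ≤ _ := by linarith
  have hmain : lam * Real.log (m + 1) + lam * (2 * √m) + √m ≤ (m : ℝ) ^ ((2 : ℝ) / 3) := by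
    have hsplit : (m : ℝ) ^ ((2 : ℝ) / 3) = √m * (m : ℝ) ^ ((1 : ℝ) / 6) := by
      rw [Real.sqrt_eq_rpow, ← Real.rpow_add hm0]; norm_num
    have h1 : (lam : ℝ) * Real.log (m + 1) ≤ Real.log m * (2 * √m) :=
      mul_le_mul hlam_log hlog_succ (Real.log_nonneg (by linarith)) (by linarith)
    have h2 : (lam : ℝ) * (2 * √m) ≤ Real.log m * (2 * √m) := by gcongr
    have h3 : 1 * √m ≤ Real.log m * √m := by gcongr
    have h4 : √m * (6 * Real.log m) ≤ √m * (m : ℝ) ^ ((1 : ℝ) / 6) := by gcongr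
    have h5 : 0 ≤ √m * Real.log m := by positivity
    rw [hsplit]
    linarith
  set A := {s : Finset (Fin m) // s.card = m / n}
  have hunion : ((Finset.univ.filter (fun Xf : Fin z → A => ∃ ℓs : Fin lam → Fin z,
      Finset.univ.biUnion (fun t => ((Xf (ℓs t)).1)ᶜ) = (Finset.univ : Finset (Fin m)))).card
        : ℝ) ≤ z ^ lam * ((m + 1) ^ lam * Real.exp (-(m / n ^ lam)) *
          Fintype.card (Fin z → A)) := by
    refine card_exists_cover_le_of_forall fun L hL => ?_
    have hL_prob := prob_empty_inter_le hn hnm L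
    refine le_trans (le_of_eq ?_) (hL_prob.trans ?_)
    · congr!
    refine mul_le_mul_of_nonneg_right ?_ (Nat.cast_nonneg _)
    refine mul_le_mul (pow_le_pow_right₀ (by linarith) hL) (Real.exp_le_exp.2 ?_)
      (Real.exp_nonneg _) (by positivity)
    refine neg_le_neg (div_le_div_of_nonneg_left hm0.le (by positivity) ?_)
    exact pow_le_pow_right₀ (by linarith) hL
  refine div_le_of_le_mul₀ (by positivity) (by positivity) (hunion.trans ?_)
  rw [← mul_assoc]
  gcongr
  have hz' : (z : ℝ) ≤ Real.exp (2 * √m) := by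
    refine hz.trans ?_
    rw [Real.rpow_def_of_pos two_pos]
    refine Real.exp_le_exp.2 (mul_le_of_le_one_left (by positivity) ?_)
    linarith [Real.log_two_lt_d9]
  calc (z : ℝ) ^ lam * ((m + 1) ^ lam * Real.exp (-(m / n ^ lam)))
      ≤ Real.exp (2 * √m) ^ lam *
        (Real.exp (Real.log (m + 1)) ^ lam * Real.exp (-(m : ℝ) ^ ((2 : ℝ) / 3))) := by
        rw [Real.exp_log (by linarith)]
        gcongr
    _ = Real.exp (lam * (2 * √m) + (lam * Real.log (m + 1) + -(m : ℝ) ^ ((2 : ℝ) / 3))) := by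
        rw [Real.exp_add, Real.exp_add, Real.exp_nat_mul, Real.exp_nat_mul]
    _ ≤ Real.exp (Real.log 2 * -(1 * √m)) := by
        refine Real.exp_le_exp.2 ?_
        have : Real.log 2 * √m ≤ 1 * √m := by
          gcongr
          linarith [Real.log_two_lt_d9]
        linarith
    _ = _ := (Real.rpow_def_of_pos two_pos _).symm
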